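/- arXiv:2602.17878 — 2 statements merged into one kernel-verified Lean document; each statement's English description precedes it below -/
import Mathlib

section
/- Under the conditions and parameter choices of the I-ALM complexity theorem (ε_0 = ε, σ = 1/2, ρ = ε⁻¹), Algorithm 3 finds an ε-primal solution—i.e., a point x ∈ dom h with |φ(x) − φ̂_*| ≤ ε and ‖Ax − b‖ ≤ ε—within a number of total ACG iterations bounded by (1 + R_Λ²)(1 + D(√((R_Λ + D)L_f/ε) + (R_Λ + D)‖A‖/ε)) up to a universal constant factor and factors polylogarithmic in the problem parameters, where R_Λ = min{‖λ − λ_0‖ : λ ∈ Λ_*} and Λ_* is the set of maximizers of the Lagrangian dual d. -/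
noncomputable section

open Set
open scoped RealInnerProductSpace BigOperators

/-- `n`-dimensional Euclidean space. -/
abbrev Euc (k : ℕ) : Type := EuclideanSpace ℝ (Fin k)

variable {n m : ℕ}

/-- `f` is `μ`-strongly convex on the set `s` (with `μ = 0` this is convexity on `s`). -/
def SCOn (s : Set (Euc n)) (mu : ℝ) (f : Euc n → ℝ) : Prop :=
  ∀ ⦃x⦄, x ∈ s → ∀ ⦃y⦄, y ∈ s → ∀ ⦃a c : ℝ⦄, 0 ≤ a → 0 ≤ c → a + c = 1 →
    f (a • x + c • y) ≤ a * f x + c * f y - mu / 2 * (a * c) * ‖x - y‖ ^ 2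

/-- The convex subdifferential of `f` at `x` relative to the domain `s`
(`f` is interpreted as `+∞` outside of `s`). -/
def subdiffOn (s : Set (Euc n)) (f : Euc n → ℝ) (x : Euc n) : Set (Euc n) :=
  {v | ∀ y ∈ s, f x + ⟪v, y - x⟫ ≤ f y}

/-- `p = prox_{η h}(x)`, where `h` is interpreted as `+∞` outside of `s`. -/
def IsProxPt (s : Set (Euc n)) (h : Euc n → ℝ) (eta : ℝ) (x p : Euc n) : Prop :=
  p ∈ s ∧ ∀ ⦃y⦄, y ∈ s → eta * h p + ‖p - x‖ ^ 2 / 2 ≤ eta * h y + ‖y - x‖ ^ 2 / 2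

/-- `f` is differentiable with gradient `f'`, and `f'` is `L`-Lipschitz (i.e. `f` is `L`-smooth). -/
def HasLipGrad (f : Euc n → ℝ) (f' : Euc n → Euc n) (L : ℝ) : Prop :=
  (∀ x, HasGradientAt f (f' x) x) ∧ ∀ x y, ‖f' x - f' y‖ ≤ L * ‖x - y‖
/-- One full run of the ACG method (Algorithm 1) on `ψ = g + h` with parameters `L`, `μ`,
started at `x0 ∈ dom h`.  The minimizations defining `ỹ_{j+1}` are taken over `dom h`
(`h` is interpreted as `+∞` outside of `dom h`). -/
def ACGSpec (domh : Set (Euc n)) (g h : Euc n → ℝ) (g' : Euc n → Euc n) (L mu : ℝ)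
    (x0 : Euc n) (x y xt yt : ℕ → Euc n) (a A tau : ℕ → ℝ) : Prop :=
  A 0 = 0 ∧ tau 0 = 1 ∧ x 0 = x0 ∧ y 0 = x0 ∧ x0 ∈ domh ∧
  (∀ j, a j = (tau j + Real.sqrt (tau j ^ 2 + 8 * tau j * A j * L)) / (4 * L)) ∧
  (∀ j, A (j + 1) = A j + a j) ∧
  (∀ j, tau (j + 1) = tau j + mu * a j) ∧
  (∀ j, xt j = (A j / A (j + 1)) • y j + (a j / A (j + 1)) • x j) ∧
  (∀ j, yt (j + 1) ∈ domh) ∧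
  (∀ j, ∀ u ∈ domh,
      g (xt j) + ⟪g' (xt j), yt (j + 1) - xt j⟫ + h (yt (j + 1)) +
          (2 * L + mu) / 2 * ‖yt (j + 1) - xt j‖ ^ 2 ≤
        g (xt j) + ⟪g' (xt j), u - xt j⟫ + h u +
          (2 * L + mu) / 2 * ‖u - xt j‖ ^ 2) ∧
  (∀ j, (y (j + 1) = y j ∨ y (j + 1) = yt (j + 1)) ∧
      g (y (j + 1)) + h (y (j + 1)) ≤ g (y j) + h (y j) ∧
      g (y (j + 1)) + h (y (j + 1)) ≤ g (yt (j + 1)) + h (yt (j + 1))) ∧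
  (∀ j, x (j + 1) = (A (j + 1) * mu + 1)⁻¹ •
      (((2 * L + mu) * a j) • yt (j + 1) -
        (2 * A j * a j * L / A (j + 1)) • y j))

/-- The aggregate lower model `Θ_j` of the ACG run: `Θ_0 ≡ 0` and
`Θ_{j+1} = (A_j Θ_j + a_j θ_{j+1})/A_{j+1}`, where
`θ_{j+1}(w) = Γ_j(ỹ_{j+1}) - L‖ỹ_{j+1} - x̃_j‖² + ⟪2L(x̃_j - ỹ_{j+1}), w - ỹ_{j+1}⟫ + (μ/2)‖w - ỹ_{j+1}‖²`
and `Γ_j(u) = g(x̃_j) + ⟪∇g(x̃_j), u - x̃_j⟫ + h(u) + ((2L+μ)/2)‖u - x̃_j‖²`. -/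
def ThetaSpec (g h : Euc n → ℝ) (g' : Euc n → Euc n) (L mu : ℝ)
    (xt yt : ℕ → Euc n) (a A : ℕ → ℝ) (Th : ℕ → Euc n → ℝ) : Prop :=
  (∀ w, Th 0 w = 0) ∧
  ∀ j w, Th (j + 1) w =
    (A j * Th j w + a j *
      (g (xt j) + ⟪g' (xt j), yt (j + 1) - xt j⟫ + h (yt (j + 1)) +
          (2 * L + mu) / 2 * ‖yt (j + 1) - xt j‖ ^ 2 -
        L * ‖yt (j + 1) - xt j‖ ^ 2 +
        ⟪(2 * L) • (xt j - yt (j + 1)), w - yt (j + 1)⟫ +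
        mu / 2 * ‖w - yt (j + 1)‖ ^ 2)) / A (j + 1)
/-- The tolerance `ε_k = (ε₀ αᵏ + σρε²)/2` of the I-ALM. -/
def epsALM (eps0 alpha sigma rho eps : ℝ) (k : ℕ) : ℝ :=
  (eps0 * alpha ^ k + sigma * rho * eps ^ 2) / 2

/-- The gradient `u ↦ ∇f(u) + Aᵀλ + ρAᵀ(Au - b)` of the smooth part of the augmented
Lagrangian `L_ρ(·,λ)`. -/
def augGrad (f' : Euc n → Euc n) (A : Euc n →L[ℝ] Euc m) (bvec : Euc m)
    (rho : ℝ) (lam : Euc m) (u : Euc n) : Euc n :=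
  f' u + (ContinuousLinearMap.adjoint A) lam +
    rho • (ContinuousLinearMap.adjoint A) (A u - bvec)

/-- A full run of the Inexact Augmented Lagrangian Method (Algorithm 3) on
`min {f + h : Ax = b}`.  At outer iteration `k`, ACG (Algorithm 1) is run on
`ψ = L_ρ(·,λ_k) + (ε_k/(8D²))‖· - x_k‖²` (with `L = M_ρ = L_f + ρ‖A‖²`,
`μ = ε_k/(4D²)`) from `x_k`; `P k j` is the prox point and `Gm k j` the gradient mapping
of `L_ρ(·,λ_k)` (with stepsize `(2L+μ)⁻¹`) at the inner iterate `x̃_j`; the inner call is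
stopped at the first index `J k` with `‖Gm k (J k)‖ ≤ ε_k/(2D)`; then
`x_{k+1} = x̃_{J k} - (2L+μ)⁻¹ Gm k (J k)` and `λ_{k+1} = λ_k + ρ(Ax_{k+1} - b)`. -/
def ALMSpec (domh : Set (Euc n)) (f h : Euc n → ℝ) (f' : Euc n → Euc n)
    (A : Euc n →L[ℝ] Euc m) (bvec : Euc m)
    (Lf D rho eps eps0 alpha sigma : ℝ)
    (xseq : ℕ → Euc n) (lamseq : ℕ → Euc m)
    (xin yin xtin ytin : ℕ → ℕ → Euc n) (ain Ain tauin : ℕ → ℕ → ℝ)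
    (P Gm : ℕ → ℕ → Euc n) (J : ℕ → ℕ) : Prop :=
  lamseq 0 = 0 ∧
  (∀ k, ACGSpec domh
      (fun u => f u + ⟪lamseq k, A u - bvec⟫ + rho / 2 * ‖A u - bvec‖ ^ 2 +
        epsALM eps0 alpha sigma rho eps k / (8 * D ^ 2) * ‖u - xseq k‖ ^ 2)
      h
      (fun u => augGrad f' A bvec rho (lamseq k) u +
        (epsALM eps0 alpha sigma rho eps k / (4 * D ^ 2)) • (u - xseq k))
      (Lf + rho * ‖A‖ ^ 2)
      (epsALM eps0 alpha sigma rho eps k / (4 * D ^ 2))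
      (xseq k) (xin k) (yin k) (xtin k) (ytin k) (ain k) (Ain k) (tauin k)) ∧
  (∀ k j, IsProxPt domh h
      (2 * (Lf + rho * ‖A‖ ^ 2) + epsALM eps0 alpha sigma rho eps k / (4 * D ^ 2))⁻¹
      (xtin k j -
        (2 * (Lf + rho * ‖A‖ ^ 2) + epsALM eps0 alpha sigma rho eps k / (4 * D ^ 2))⁻¹ •
          augGrad f' A bvec rho (lamseq k) (xtin k j))
      (P k j)) ∧
  (∀ k j, Gm k j =
      (2 * (Lf + rho * ‖A‖ ^ 2) + epsALM eps0 alpha sigma rho eps k / (4 * D ^ 2)) •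
        (xtin k j - P k j)) ∧
  (∀ k, ‖Gm k (J k)‖ ≤ epsALM eps0 alpha sigma rho eps k / (2 * D)) ∧
  (∀ k j, j < J k → ¬(‖Gm k j‖ ≤ epsALM eps0 alpha sigma rho eps k / (2 * D))) ∧
  (∀ k, xseq (k + 1) = xtin k (J k) -
      (2 * (Lf + rho * ‖A‖ ^ 2) + epsALM eps0 alpha sigma rho eps k / (4 * D ^ 2))⁻¹ •
        Gm k (J k)) ∧
  (∀ k, lamseq (k + 1) = lamseq k + rho • (A (xseq (k + 1)) - bvec))
/-!
STATEMENT 4 (Corollary: iteration-complexity of the I-ALM to find an `ε`-primal solution).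
The algorithm is run with the parameter choices of the complexity theorem at a suitably
chosen internal target accuracy `eps' ≤ eps` (namely `ε₀ = eps'`, `σ = 1/2`, `ρ = eps'⁻¹`);
the output is an `ε`-primal solution and the total ACG iteration count is bounded as stated.
-/


section helpers
variable {E : Type*} [NormedAddCommGroup E] [InnerProductSpace ℝ E]

lemma nonneg_of_quad {al be : ℝ} (H : ∀ t : ℝ, 0 < t → t ≤ 1 → 0 ≤ t * al + t ^ 2 * be) : 0 ≤ al := by
  by_contra hneg
  push Not at hneg
  have hb : 0 < |be| + 1 := by positivity
  set t := min 1 (-al / (2 * (|be| + 1))) with ht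
  have h1 : 0 < -al / (2 * (|be| + 1)) := by apply div_pos <;> linarith
  have t0 : 0 < t := lt_min one_pos h1
  have t1 : t ≤ 1 := min_le_left _ _
  have t2 : t ≤ -al / (2 * (|be| + 1)) := min_le_right _ _
  have h2 := H t t0 t1
  rw [le_div_iff₀ (by positivity)] at t2
  have h3 : 0 ≤ al + t * be := by
    by_contra hc
    push Not at hc
    have := mul_neg_of_pos_of_neg t0 hc
    nlinarith
  have h4 : t * be ≤ t * |be| := mul_le_mul_of_nonneg_left (le_abs_self _) t0.le
  nlinarith

lemma acg_step {Aj a A' tau tau' L mu psy psu psyt : ℝ} {y x xt yt u x' : E}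
    (hmu : 0 < mu) (hAj : 0 ≤ Aj) (ha : 0 < a) (htau : 0 < tau)
    (hA : A' = Aj + a) (h2 : 2 * L * a ^ 2 = tau * A') (ht : tau' = tau + mu * a)
    (hxt : A' • xt = Aj • y + a • x)
    (hx' : tau' • x' = tau • x + (a * mu) • yt - (2 * L * a) • (xt - yt))
    (hu : psyt - L / 2 * ‖xt - yt‖ ^ 2 + 2 * L * inner ℝ (xt - yt) (u - yt) +
      mu / 2 * ‖u - yt‖ ^ 2 ≤ psu)
    (hy : psyt - L / 2 * ‖xt - yt‖ ^ 2 + 2 * L * inner ℝ (xt - yt) (y - yt) +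
      mu / 2 * ‖y - yt‖ ^ 2 ≤ psy) :
    A' * psyt + tau' / 2 * ‖x' - u‖ ^ 2 + A' * (L / 2) * ‖xt - yt‖ ^ 2 ≤
      Aj * psy + a * psu + tau / 2 * ‖x - u‖ ^ 2 := by
  set e := xt - yt with he
  have k1 : Aj * inner ℝ e (y - yt) + a * inner ℝ e (u - yt) =
      A' * ‖e‖ ^ 2 + a * inner ℝ e (u - x) := by
    rw [← real_inner_self_eq_norm_sq, ← inner_smul_right, ← inner_smul_right, ← inner_smul_right,
      ← inner_smul_right, ← inner_add_right, ← inner_add_right]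
    congr 1
    have : A' • e = Aj • y + a • x - A' • yt := by rw [he, smul_sub, hxt]
    rw [this, hA]; module
  have k2 : tau / 2 * ‖u - x‖ ^ 2 + 2 * L * a * inner ℝ e (u - x) + a * mu / 2 * ‖u - yt‖ ^ 2
      = tau / 2 * ‖x' - x‖ ^ 2 + 2 * L * a * inner ℝ e (x' - x) + a * mu / 2 * ‖x' - yt‖ ^ 2
        + tau' / 2 * ‖u - x'‖ ^ 2 := by
    have z : inner ℝ (tau • (x' - x) + (2 * L * a) • e + (a * mu) • (x' - yt)) (u - x') = 0 := by
      have : tau • (x' - x) + (2 * L * a) • e + (a * mu) • (x' - yt) = 0 := by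
        have : tau • (x' - x) + (2 * L * a) • e + (a * mu) • (x' - yt)
          = tau' • x' - (tau • x + (a * mu) • yt - (2 * L * a) • e) := by rw [ht]; module
        rw [this, hx', sub_self]
      rw [this, inner_zero_left]
    rw [inner_add_left, inner_add_left, real_inner_smul_left, real_inner_smul_left,
      real_inner_smul_left] at z
    have q1 : ‖u - x‖ ^ 2 = ‖x' - x‖ ^ 2 + 2 * inner ℝ (x' - x) (u - x') + ‖u - x'‖ ^ 2 := by
      rw [← norm_add_sq_real]; congr 2; abel
    have q2 : ‖u - yt‖ ^ 2 = ‖x' - yt‖ ^ 2 + 2 * inner ℝ (x' - yt) (u - x') + ‖u - x'‖ ^ 2 := by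
      rw [← norm_add_sq_real]; congr 2; abel
    have q3 : inner ℝ e (u - x) = inner ℝ e (x' - x) + inner ℝ e (u - x') := by
      rw [← inner_add_right]; congr 1; abel
    rw [q1, q2, q3, ht]
    linear_combination z
  have k3 : -(L * A' * ‖e‖ ^ 2) ≤ tau / 2 * ‖x' - x‖ ^ 2 + 2 * L * a * inner ℝ e (x' - x) := by
    have : 0 ≤ ‖tau • (x' - x) + (2 * L * a) • e‖ ^ 2 := by positivity
    rw [norm_add_sq_real, norm_smul, norm_smul, real_inner_smul_left, real_inner_smul_right,
      mul_pow, mul_pow, Real.norm_eq_abs, Real.norm_eq_abs, sq_abs, sq_abs, real_inner_comm] at this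
    have h3 : (2 * L * a) ^ 2 = 2 * L * (tau * A') := by rw [← h2]; ring
    rw [h3] at this
    have h4 : 0 ≤ tau * (tau / 2 * ‖x' - x‖ ^ 2 + 2 * L * a * inner ℝ e (x' - x) +
        L * A' * ‖e‖ ^ 2) := by nlinarith
    have := nonneg_of_mul_nonneg_right h4 htau
    linarith
  have k4 : 0 ≤ a * mu / 2 * ‖x' - yt‖ ^ 2 := by positivity
  have k5 : 0 ≤ Aj * (mu / 2 * ‖y - yt‖ ^ 2) := by positivity
  have m1 := mul_le_mul_of_nonneg_left hu ha.le
  have m2 := mul_le_mul_of_nonneg_left hy hAj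
  rw [norm_sub_rev x' u, norm_sub_rev x u]
  subst hA
  linarith [congrArg (fun z => 2 * L * z) k1]

lemma prox_fo {s : Set E} {h : E → ℝ} (hh : ConvexOn ℝ s h) {v z p : E} {c : ℝ}
    (hp : p ∈ s)
    (H : ∀ u ∈ s, inner ℝ v (p - z) + h p + c / 2 * ‖p - z‖ ^ 2 ≤
      inner ℝ v (u - z) + h u + c / 2 * ‖u - z‖ ^ 2) :
    ∀ u ∈ s, h p ≤ h u + inner ℝ v (u - p) + c * inner ℝ (p - z) (u - p) := by
  intro u hu
  suffices 0 ≤ h u - h p + inner ℝ v (u - p) + c * inner ℝ (p - z) (u - p) by linarith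
  apply nonneg_of_quad (be := c / 2 * ‖u - p‖ ^ 2)
  intro t t0 t1
  have hw : (1 - t) • p + t • u ∈ s := hh.1 hp hu (by linarith) t0.le (by ring)
  have hc := hh.2 hp hu (by linarith : 0 ≤ 1 - t) t0.le (by ring)
  have h1 := H _ hw
  have e1 : (1 - t) • p + t • u - z = (p - z) + t • (u - p) := by module
  rw [e1, norm_add_sq_real, inner_add_right, real_inner_smul_right, real_inner_smul_right,
    norm_smul, mul_pow, Real.norm_eq_abs, sq_abs] at h1
  simp only [smul_eq_mul] at hc
  linarith

lemma line_hasDeriv {n : ℕ} {f : Euc n → ℝ} {f' : Euc n → Euc n} (hf : ∀ x, HasGradientAt f (f' x) x)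
    (x y : Euc n) (t : ℝ) :
    HasDerivAt (fun t : ℝ => f (x + t • (y - x))) (⟪f' (x + t • (y - x)), y - x⟫) t := by
  have h1 := (hf (x + t • (y - x))).hasFDerivAt
  have h2 : HasDerivAt (fun t : ℝ => x + t • (y - x)) (y - x) t := by
    simpa using ((hasDerivAt_id t).smul_const (y - x)).const_add x
  have := h1.comp_hasDerivAt t h2
  simp only [InnerProductSpace.toDual_apply_apply] at this
  exact this

lemma descent {n : ℕ} {f : Euc n → ℝ} {f' : Euc n → Euc n} {L : ℝ} (hf : HasLipGrad f f' L)
    (x y : Euc n) : f y ≤ f x + ⟪f' x, y - x⟫ + L / 2 * ‖y - x‖ ^ 2 := by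
  let F : ℝ → ℝ := fun t => f (x + t • (y - x)) - t * ⟪f' x, y - x⟫ - L / 2 * ‖y - x‖ ^ 2 * t ^ 2
  have hd : ∀ t, HasDerivAt F (⟪f' (x + t • (y - x)), y - x⟫ - ⟪f' x, y - x⟫
      - L * ‖y - x‖ ^ 2 * t) t := by
    intro t
    have := ((line_hasDeriv hf.1 x y t).sub ((hasDerivAt_id t).mul_const ⟪f' x, y - x⟫)).sub
      (((hasDerivAt_id t).pow 2).const_mul (L / 2 * ‖y - x‖ ^ 2))
    refine this.congr_deriv ?_
    simp only [id]; push_cast; ring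
  have anti : AntitoneOn F (Set.Icc 0 1) := by
    apply antitoneOn_of_deriv_nonpos (convex_Icc 0 1)
    · exact fun t _ => (hd t).continuousAt.continuousWithinAt
    · exact fun t _ => (hd t).differentiableAt.differentiableWithinAt
    · intro t ht
      rw [interior_Icc] at ht
      rw [(hd t).deriv, ← inner_sub_left]
      have h1 := real_inner_le_norm (f' (x + t • (y - x)) - f' x) (y - x)
      have h2 := hf.2 (x + t • (y - x)) x
      rw [add_sub_cancel_left, norm_smul, Real.norm_eq_abs, abs_of_pos ht.1] at h2
      have h3 := mul_le_mul_of_nonneg_right h2 (norm_nonneg (y - x))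
      nlinarith
  have := anti (Set.left_mem_Icc.2 zero_le_one) (Set.right_mem_Icc.2 zero_le_one) zero_le_one
  simp [F] at this
  linarith

lemma convex_fo {n : ℕ} {f : Euc n → ℝ} {f' : Euc n → Euc n} (hc : ConvexOn ℝ Set.univ f)
    (hf : ∀ x, HasGradientAt f (f' x) x)
    (x y : Euc n) : f x + ⟪f' x, y - x⟫ ≤ f y := by
  have hconv : ConvexOn ℝ Set.univ (fun t : ℝ => f (x + t • (y - x))) := by
    refine ⟨convex_univ, ?_⟩
    intro s _ t _ a b ha hb hab
    have := hc.2 (Set.mem_univ (x + s • (y - x))) (Set.mem_univ (x + t • (y - x))) ha hb hab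
    refine le_trans (le_of_eq ?_) this
    show f _ = f _
    congr 1
    have : x = a • x + b • x := by rw [← add_smul, hab, one_smul]
    nth_rewrite 1 [this]
    simp only [smul_eq_mul]
    module
  have hd := line_hasDeriv hf x y 0
  have := hconv.le_slope_of_hasDerivAt (Set.mem_univ 0) (Set.mem_univ 1) zero_lt_one hd
  simp [slope_def_field] at this
  linarith
end helpers

lemma acg_bounds {n : ℕ} {domh : Set (Euc n)} {g h : Euc n → ℝ} {g' : Euc n → Euc n} {L mu : ℝ}
    {x0 : Euc n} {x y xt yt : ℕ → Euc n} {a A tau : ℕ → ℝ}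
    (S : ACGSpec domh g h g' L mu x0 x y xt yt a A tau)
    (hL : 0 < L) (hmu : 0 < mu) (hh : ConvexOn ℝ domh h)
    (hlo : ∀ x u, g x + ⟪g' x, u - x⟫ + mu / 2 * ‖u - x‖ ^ 2 ≤ g u)
    (hup : ∀ x u, g u ≤ g x + ⟪g' x, u - x⟫ + (L + mu) / 2 * ‖u - x‖ ^ 2)
    {xs : Euc n} (hxs : xs ∈ domh) (hmin : ∀ u ∈ domh, g xs + h xs ≤ g u + h u) (j : ℕ) :
    L * A (j + 1) * ‖xt j - yt (j + 1)‖ ^ 2 ≤ ‖x0 - xs‖ ^ 2 ∧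
    (1 + Real.sqrt (mu / (2 * L))) ^ j ≤ 2 * L * A (j + 1) := by
  obtain ⟨hA0, htau0, hx0, hy0, hx0m, ha, hA, htau, hxt, hytm, hyt, hy, hx⟩ := S
  have basic : ∀ j, 0 ≤ A j ∧ tau j = 1 + mu * A j := by
    intro j
    induction j with
    | zero => simp [hA0, htau0]
    | succ j ih =>
      obtain ⟨i1, i2⟩ := ih
      have : 0 ≤ tau j := by rw [i2]; positivity
      refine ⟨?_, by rw [htau, hA, i2]; ring⟩
      rw [hA, ha]; positivity
  have taupos : ∀ j, 0 < tau j := by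
    intro j; rw [(basic j).2]; have := (basic j).1; positivity
  have apos : ∀ j, 0 < a j := by
    intro j; rw [ha]; have := taupos j; positivity
  have A1pos : ∀ j, 0 < A (j + 1) := by
    intro j; rw [hA]; have := (basic j).1; have := apos j; linarith
  have hquad : ∀ j, 2 * L * a j ^ 2 = tau j * A (j + 1) := by
    intro j
    have h0 := (basic j).1
    have h1 := taupos j
    have hs := Real.sq_sqrt (show 0 ≤ tau j ^ 2 + 8 * tau j * A j * L by positivity)
    rw [hA, ha]
    generalize Real.sqrt (tau j ^ 2 + 8 * tau j * A j * L) = w at hs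
    field_simp
    linear_combination 2 * hs
  have ymem : ∀ j, y j ∈ domh := by
    intro j
    induction j with
    | zero => rw [hy0]; exact hx0m
    | succ j ih =>
      rcases (hy j).1 with h1 | h1 <;> rw [h1]
      · exact ih
      · exact hytm j
  have theta : ∀ j, ∀ u ∈ domh,
      (g (yt (j + 1)) + h (yt (j + 1))) - L / 2 * ‖xt j - yt (j + 1)‖ ^ 2 +
        2 * L * ⟪xt j - yt (j + 1), u - yt (j + 1)⟫ + mu / 2 * ‖u - yt (j + 1)‖ ^ 2 ≤ g u + h u := by
    intro j u hu
    have fo := prox_fo (v := g' (xt j)) (z := xt j) (c := 2 * L + mu) hh (hytm j)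
      (fun u hu => by have := hyt j u hu; linarith) u hu
    have l1 := hlo (xt j) u
    have l2 := hup (xt j) (yt (j + 1))
    have e1 : u - xt j = (yt (j + 1) - xt j) + (u - yt (j + 1)) := by abel
    have e2 : xt j - yt (j + 1) = -(yt (j + 1) - xt j) := by abel
    rw [e1, inner_add_right, norm_add_sq_real] at l1
    rw [e2, norm_neg, inner_neg_left]
    linarith
  have step : ∀ j, A (j + 1) * (g (y (j + 1)) + h (y (j + 1)) - (g xs + h xs)) +
      tau (j + 1) / 2 * ‖x (j + 1) - xs‖ ^ 2 + A (j + 1) * (L / 2) * ‖xt j - yt (j + 1)‖ ^ 2 ≤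
      A j * (g (y j) + h (y j) - (g xs + h xs)) + tau j / 2 * ‖x j - xs‖ ^ 2 := by
    intro j
    have hne := (A1pos j).ne'
    have hxt' : A (j + 1) • xt j = A j • y j + a j • x j := by
      rw [hxt, smul_add, smul_smul, smul_smul, mul_div_cancel₀ _ hne, mul_div_cancel₀ _ hne]
    have hx' : tau (j + 1) • x (j + 1) =
        tau j • x j + (a j * mu) • yt (j + 1) - (2 * L * a j) • (xt j - yt (j + 1)) := by
      have t1 : A (j + 1) * mu + 1 = tau (j + 1) := by rw [(basic (j + 1)).2]; ring
      rw [hx, t1, smul_smul, mul_inv_cancel₀ (taupos _).ne', one_smul]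
      have e : (2 * A j * a j * L / A (j + 1)) • y j = (2 * L * a j) • xt j - tau j • x j := by
        have : tau j = (2 * L * a j / A (j + 1)) * a j := by
          field_simp; linarith [hquad j]
        have e2 : (2 * L * a j) • xt j = (2 * L * a j / A (j + 1)) • (A (j + 1) • xt j) := by
          rw [smul_smul, div_mul_cancel₀ _ hne]
        rw [e2, hxt', this, smul_add, smul_smul, smul_smul, add_sub_cancel_right]
        congr 1; ring
      rw [e]; module
    have := acg_step hmu (basic j).1 (apos j) (taupos j) (hA j) (hquad j) (htau j)
      hxt' hx' (theta j xs hxs) (theta j (y j) (ymem j))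
    have m := mul_le_mul_of_nonneg_left (hy j).2.2 (A1pos j).le
    have hAj := hA j
    have : A (j + 1) * (g xs + h xs) = A j * (g xs + h xs) + a j * (g xs + h xs) := by
      rw [hAj]; ring
    linarith
  have pot : ∀ j, A j * (g (y j) + h (y j) - (g xs + h xs)) + tau j / 2 * ‖x j - xs‖ ^ 2 ≤
      ‖x0 - xs‖ ^ 2 / 2 := by
    intro j
    induction j with
    | zero => rw [hA0, htau0, hx0]; apply le_of_eq; ring
    | succ j ih =>
      have := step j
      have : 0 ≤ A (j + 1) * (L / 2) * ‖xt j - yt (j + 1)‖ ^ 2 := by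
        have := A1pos j; positivity
      linarith
  constructor
  · have h1 := step j
    have h2 := pot j
    have h3 : 0 ≤ A (j + 1) * (g (y (j + 1)) + h (y (j + 1)) - (g xs + h xs)) :=
      mul_nonneg (A1pos j).le (by linarith [hmin _ (ymem (j + 1))])
    have h4 : 0 ≤ tau (j + 1) / 2 * ‖x (j + 1) - xs‖ ^ 2 := by
      have := taupos (j + 1); positivity
    linarith
  · clear step pot theta
    induction j with
    | zero =>
      have h1 := hquad 0
      have h2 := hA 0
      rw [hA0] at h2
      rw [htau0, h2] at h1
      have h3 := apos 0
      have : 2 * L * a 0 = 1 := by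
        have : a 0 * (2 * L * a 0 - 1) = 0 := by linear_combination h1
        rcases mul_eq_zero.1 this with h | h
        · exact absurd h h3.ne'
        · linarith
      rw [zero_add, h2, zero_add, this]; simp
    | succ j ih =>
      set r := Real.sqrt (mu / (2 * L)) with hr
      have r0 : 0 ≤ r := Real.sqrt_nonneg _
      have r2 : r ^ 2 * (2 * L) = mu := by
        rw [hr, Real.sq_sqrt (by positivity)]; field_simp
      have hB := A1pos j
      have q := hquad (j + 1)
      have hA2 := hA (j + 1)
      have key : r * A (j + 1) ≤ a (j + 1) := by
        refine (le_abs_self _).trans (abs_le_of_sq_le_sq ?_ (apos _).le)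
        have : 2 * L * (r * A (j + 1)) ^ 2 ≤ 2 * L * a (j + 1) ^ 2 := by
          have e : 2 * L * (r * A (j + 1)) ^ 2 = mu * A (j + 1) * A (j + 1) := by
            rw [← r2]; ring
          rw [e, q, (basic (j + 1)).2]
          have := apos (j + 1)
          have hA' : A (j + 1) ≤ A (j + 1 + 1) := by linarith
          apply mul_le_mul _ hA' hB.le (by positivity)
          linarith
        exact le_of_mul_le_mul_left this (by positivity)
      rw [pow_succ]
      calc _ ≤ 2 * L * A (j + 1) * (1 + r) := mul_le_mul_of_nonneg_right ih (by positivity)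
        _ ≤ _ := by rw [hA2]; nlinarith

lemma J_bound {n : ℕ} {domh : Set (Euc n)} {g h : Euc n → ℝ} {g' q' : Euc n → Euc n} {L mu D : ℝ}
    {x0 : Euc n} {x y xt yt : ℕ → Euc n} {a A tau : ℕ → ℝ} {P Gm : ℕ → Euc n} {J : ℕ}
    (S : ACGSpec domh g h g' L mu x0 x y xt yt a A tau)
    (hL : 0 < L) (hmu : 0 < mu) (hD : 1 ≤ D) (hh : ConvexOn ℝ domh h)
    (hdiam : ∀ u ∈ domh, ∀ w ∈ domh, ‖u - w‖ ≤ D)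
    (hlo : ∀ x u, g x + ⟪g' x, u - x⟫ + mu / 2 * ‖u - x‖ ^ 2 ≤ g u)
    (hup : ∀ x u, g u ≤ g x + ⟪g' x, u - x⟫ + (L + mu) / 2 * ‖u - x‖ ^ 2)
    {xs : Euc n} (hxs : xs ∈ domh) (hmin : ∀ u ∈ domh, g xs + h xs ≤ g u + h u)
    (hq : ∀ u, g' u = q' u + mu • (u - x0))
    (hPm : ∀ j, P j ∈ domh)
    (hP : ∀ j, ∀ u ∈ domh, h (P j) ≤ h u + ⟪q' (xt j), u - P j⟫ +
      (2 * L + mu) * ⟪P j - xt j, u - P j⟫)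
    (hG : ∀ j, Gm j = (2 * L + mu) • (xt j - P j))
    (hJ : ∀ j, j < J → ¬ (‖Gm j‖ ≤ 2 * mu * D)) :
    (J : ℝ) ≤ (1 + Real.sqrt (2 * (L / mu))) * Real.log (8 * (1 + L / mu) ^ 2) + 1 := by
  by_contra hcon
  push Not at hcon
  set r := Real.sqrt (mu / (2 * L)) with hr
  have r0 : 0 < r := Real.sqrt_pos.2 (by positivity)
  have hri : Real.sqrt (2 * (L / mu)) = r⁻¹ := by
    rw [hr, ← Real.sqrt_inv]; congr 1; field_simp
  set B := Real.log (8 * (1 + L / mu) ^ 2) with hB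
  have hB1 : 1 ≤ 8 * (1 + L / mu) ^ 2 := by
    have : 0 ≤ L / mu := by positivity
    nlinarith
  have hB0 : 0 ≤ B := Real.log_nonneg hB1
  rw [hri] at hcon
  set j := ⌈(1 + r⁻¹) * B⌉₊ with hj
  have hj1 : (1 + r⁻¹) * B ≤ j := Nat.le_ceil _
  have hj2 : (j : ℝ) < (1 + r⁻¹) * B + 1 := Nat.ceil_lt_add_one (by positivity)
  have hjJ : j < J := by
    have : (j : ℝ) < J := by linarith
    exact_mod_cast this
  apply hJ j hjJ
  obtain ⟨b1, b2⟩ := acg_bounds S hL hmu hh hlo hup hxs hmin j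
  have hpow : 8 * (1 + L / mu) ^ 2 ≤ (1 + r) ^ j := by
    rw [← Real.log_le_log_iff (by linarith) (by positivity), Real.log_pow]
    have l1 : 1 - (1 + r)⁻¹ ≤ Real.log (1 + r) := Real.one_sub_inv_le_log_of_pos (by positivity)
    have l2 : (1 + r⁻¹) * (1 - (1 + r)⁻¹) = 1 := by field_simp; ring
    calc B = ((1 + r⁻¹) * B) * (1 - (1 + r)⁻¹) := by linear_combination (-B) * l2
      _ ≤ j * Real.log (1 + r) := by
        apply mul_le_mul hj1 l1 _ (by positivity)
        have : (1 + r)⁻¹ ≤ 1 := inv_le_one_of_one_le₀ (by linarith)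
        linarith
  obtain ⟨-, -, -, -, hx0m, -, -, -, -, hytm, hyt, -, -⟩ := S
  set e := ‖xt j - yt (j + 1)‖ with he
  have e0 : 0 ≤ e := norm_nonneg _
  have h1 : 8 * (1 + L / mu) ^ 2 * e ^ 2 ≤ 2 * D ^ 2 := by
    have s1 := mul_le_mul_of_nonneg_right (hpow.trans b2) (sq_nonneg e)
    have s2 : ‖x0 - xs‖ ^ 2 ≤ D ^ 2 := pow_le_pow_left₀ (norm_nonneg _) (hdiam _ hx0m _ hxs) 2
    linarith
  have h2 : (2 * L + 2 * mu) * e ≤ mu * D := by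
    have : 2 * (1 + L / mu) * e ≤ D := by
      refine (le_abs_self _).trans (abs_le_of_sq_le_sq ?_ (by linarith))
      nlinarith
    have h3 := mul_le_mul_of_nonneg_left this hmu.le
    have h4 : mu * (2 * (1 + L / mu) * e) = (2 * L + 2 * mu) * e := by field_simp; ring
    linarith
  -- nonexpansiveness
  have fo := prox_fo (v := g' (xt j)) (z := xt j) (c := 2 * L + mu) hh (hytm j)
      (fun u hu => by have := hyt j u hu; linarith) (P j) (hPm j)
  have fo2 := hP j (yt (j + 1)) (hytm j)
  have h5 : (2 * L + mu) * ‖P j - yt (j + 1)‖ ≤ mu * ‖xt j - x0‖ := by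
    rw [hq, inner_add_left, real_inner_smul_left] at fo
    have e3 : yt (j + 1) - P j = -(P j - yt (j + 1)) := by abel
    have e4 : P j - xt j = (yt (j + 1) - xt j) + (P j - yt (j + 1)) := by abel
    rw [e3, inner_neg_right, inner_neg_right, e4, inner_add_left, real_inner_self_eq_norm_sq] at fo2
    have cs := real_inner_le_norm (xt j - x0) (P j - yt (j + 1))
    rcases eq_or_lt_of_le (norm_nonneg (P j - yt (j + 1))) with hz | hz
    · rw [← hz]; simp; positivity
    · refine le_of_mul_le_mul_right ?_ hz
      have := mul_le_mul_of_nonneg_left cs hmu.le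
      linarith
  have h6 : ‖xt j - x0‖ ≤ e + D := by
    have : xt j - x0 = (xt j - yt (j + 1)) + (yt (j + 1) - x0) := by abel
    rw [this]
    exact (norm_add_le _ _).trans (add_le_add le_rfl (hdiam _ (hytm j) _ hx0m))
  have h7 : ‖xt j - P j‖ ≤ e + ‖P j - yt (j + 1)‖ := by
    have : xt j - P j = (xt j - yt (j + 1)) - (P j - yt (j + 1)) := by abel
    rw [this]
    exact norm_sub_le _ _
  rw [hG, norm_smul, Real.norm_eq_abs, abs_of_pos (by positivity)]
  have h8 := mul_le_mul_of_nonneg_left h7 (show 0 ≤ 2 * L + mu by positivity)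
  have h9 := mul_le_mul_of_nonneg_left h6 hmu.le
  linarith

lemma exists_min {n : ℕ} {domh : Set (Euc n)} {h : Euc n → ℝ} {D : ℝ}
    (hcl : IsClosed domh) (hls : LowerSemicontinuousOn h domh) (hne : domh.Nonempty)
    (hdiam : ∀ u ∈ domh, ∀ w ∈ domh, ‖u - w‖ ≤ D) (g : Euc n → ℝ) (hg : Continuous g) :
    ∃ xs ∈ domh, ∀ u ∈ domh, g xs + h xs ≤ g u + h u := by
  have hb : Bornology.IsBounded domh := by
    rw [Metric.isBounded_iff]
    exact ⟨D, fun x hx y hy => by rw [dist_eq_norm]; exact hdiam x hx y hy⟩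
  have hK := Metric.isCompact_of_isClosed_isBounded hcl hb
  have hl : LowerSemicontinuousOn (fun u => g u + h u) domh :=
    (hg.lowerSemicontinuous.lowerSemicontinuousOn domh).add hls
  obtain ⟨xs, hxs, hm⟩ := hl.exists_isMinOn hne hK
  exact ⟨xs, hxs, fun u hu => hm hu⟩

lemma grad_cont {n : ℕ} {f : Euc n → ℝ} {f' : Euc n → Euc n} {L : ℝ} (hf : HasLipGrad f f' L) :
    Continuous f :=
  continuous_iff_continuousAt.2 fun x => (hf.1 x).continuousAt

lemma strong_dual {n m : ℕ} {domh : Set (Euc n)} {f h : Euc n → ℝ}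
    {A : Euc n →L[ℝ] Euc m} {b : Euc m} {D : ℝ}
    (hfc : ConvexOn ℝ Set.univ f) (hfcont : Continuous f) (hh : ConvexOn ℝ domh h)
    (hcl : IsClosed domh) (hls : LowerSemicontinuousOn h domh) (hne : domh.Nonempty)
    (hdiam : ∀ u ∈ domh, ∀ w ∈ domh, ‖u - w‖ ≤ D) {phistar : ℝ}
    (hopt : ∀ u ∈ domh, A u = b → phistar ≤ f u + h u) {d : Euc m → ℝ}
    (hd : ∀ lam : Euc m,
            IsLeast ((fun x => f x + h x + ⟪lam, A x - b⟫) '' domh) (d lam))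
    {lamstar : Euc m} (hmax : ∀ nu : Euc m, d nu ≤ d lamstar) :
    ∀ u ∈ domh, phistar ≤ f u + h u + ⟪lamstar, A u - b⟫ := by
  obtain ⟨xs, hxs, hmin⟩ := exists_min hcl hls hne hdiam
    (fun u => f u + ⟪lamstar, A u - b⟫ + 1 / 2 * ‖A u - b‖ ^ 2) (by fun_prop)
  set r := A xs - b with hr
  have fo : ∀ u ∈ domh, f xs + h xs + ⟪lamstar + r, r⟫ ≤ f u + h u + ⟪lamstar + r, A u - b⟫ := by
    intro u hu
    suffices 0 ≤ (f u + h u + ⟪lamstar + r, A u - b⟫) - (f xs + h xs + ⟪lamstar + r, r⟫) by linarith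
    apply nonneg_of_quad (be := 1 / 2 * ‖A u - b - r‖ ^ 2)
    intro t t0 t1
    have hw : (1 - t) • xs + t • u ∈ domh := hh.1 hxs hu (by linarith) t0.le (by ring)
    have c1 := hh.2 hxs hu (by linarith : 0 ≤ 1 - t) t0.le (by ring)
    have c2 := hfc.2 (Set.mem_univ xs) (Set.mem_univ u) (by linarith : 0 ≤ 1 - t) t0.le (by ring)
    have h1 := hmin _ hw
    have e1 : A ((1 - t) • xs + t • u) - b = r + t • (A u - b - r) := by
      rw [map_add, map_smul, map_smul, hr]; module
    simp only [e1] at h1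
    rw [norm_add_sq_real, inner_add_right, real_inner_smul_right, real_inner_smul_right,
      norm_smul, mul_pow, Real.norm_eq_abs, sq_abs] at h1
    simp only [smul_eq_mul] at c1 c2
    have i1 : ⟪lamstar + r, A u - b⟫ - ⟪lamstar + r, r⟫ =
        ⟪lamstar, A u - b - r⟫ + ⟪r, A u - b - r⟫ := by
      rw [← inner_sub_right, inner_add_left]
    have i2 := congrArg (fun z => t * z) i1
    linarith
  obtain ⟨x1, hx1, e1⟩ := (hd (lamstar + r)).1
  have l1 := (hd lamstar).2 ⟨xs, hxs, rfl⟩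
  have f1 := fo x1 hx1
  have m1 := hmax (lamstar + r)
  simp only at e1 l1
  rw [← hr] at l1
  rw [inner_add_left, real_inner_self_eq_norm_sq] at f1
  have hr2 : ‖r‖ ^ 2 ≤ 0 := by linarith
  have hr0 : r = 0 := by
    have : ‖r‖ = 0 := by nlinarith [norm_nonneg r]
    exact norm_eq_zero.1 this
  have ho := hopt xs hxs (by rw [← sub_eq_zero, ← hr, hr0])
  intro u hu
  have := fo u hu
  rw [hr0] at this
  simp at this
  linarith

lemma prox_fo2 {n : ℕ} {s : Set (Euc n)} {h : Euc n → ℝ} (hh : ConvexOn ℝ s h) {v z p : Euc n} {c : ℝ}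
    (hc : 0 < c) (H : IsProxPt s h c⁻¹ (z - c⁻¹ • v) p) :
    ∀ u ∈ s, h p ≤ h u + ⟪v, u - p⟫ + c * ⟪p - z, u - p⟫ := by
  apply prox_fo hh H.1
  intro u hu
  have h1 := mul_le_mul_of_nonneg_left (H.2 hu) hc.le
  have e : ∀ w, c * (c⁻¹ * h w + ‖w - (z - c⁻¹ • v)‖ ^ 2 / 2) =
      ⟪v, w - z⟫ + h w + c / 2 * ‖w - z‖ ^ 2 + c⁻¹ * ‖v‖ ^ 2 / 2 := by
    intro w
    have : w - (z - c⁻¹ • v) = (w - z) + c⁻¹ • v := by abel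
    rw [this, norm_add_sq_real, real_inner_smul_right, norm_smul, mul_pow, Real.norm_eq_abs, sq_abs,
      real_inner_comm]
    field_simp
    ring
  rw [e, e] at h1
  linarith

lemma aug_eq {n m : ℕ} (f : Euc n → ℝ) (f' : Euc n → Euc n) (A : Euc n →L[ℝ] Euc m) (b lam : Euc m)
    (rho mu : ℝ) (x0 x u : Euc n) :
    (f u + ⟪lam, A u - b⟫ + rho / 2 * ‖A u - b‖ ^ 2 + mu / 2 * ‖u - x0‖ ^ 2) =
    (f x + ⟪lam, A x - b⟫ + rho / 2 * ‖A x - b‖ ^ 2 + mu / 2 * ‖x - x0‖ ^ 2) +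
      ⟪augGrad f' A b rho lam x + mu • (x - x0), u - x⟫ +
      (f u - f x - ⟪f' x, u - x⟫) + rho / 2 * ‖A (u - x)‖ ^ 2 + mu / 2 * ‖u - x‖ ^ 2 := by
  have e1 : A u - b = (A x - b) + A (u - x) := by rw [map_sub]; abel
  have e2 : u - x0 = (x - x0) + (u - x) := by abel
  rw [e1, e2, norm_add_sq_real, norm_add_sq_real, augGrad, inner_add_left, inner_add_left,
    inner_add_left, real_inner_smul_left, real_inner_smul_left,
    ContinuousLinearMap.adjoint_inner_left, ContinuousLinearMap.adjoint_inner_left, inner_add_right]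
  ring

lemma alm_step {n m : ℕ} {domh : Set (Euc n)} {f h : Euc n → ℝ} {f' : Euc n → Euc n}
    {A : Euc n →L[ℝ] Euc m} {b lam : Euc m} {Lf D rho mu : ℝ}
    (hLf : 0 < Lf) (hrho : 0 < rho) (hmu : 0 < mu)
    (hfc : ConvexOn ℝ Set.univ f) (hf : HasLipGrad f f' Lf)
    (hdiam : ∀ u ∈ domh, ∀ w ∈ domh, ‖u - w‖ ≤ D)
    {xo xt P : Euc n} (hxo : xo ∈ domh) (hAo : A xo = b) (hPm : P ∈ domh)
    (hP : ∀ u ∈ domh, h P ≤ h u + ⟪augGrad f' A b rho lam xt, u - P⟫ +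
      (2 * (Lf + rho * ‖A‖ ^ 2) + mu) * ⟪P - xt, u - P⟫)
    (hG : ‖(2 * (Lf + rho * ‖A‖ ^ 2) + mu) • (xt - P)‖ ≤ 2 * mu * D) :
    f P + h P + ⟪lam, A P - b⟫ + 3 / 4 * rho * ‖A P - b‖ ^ 2 ≤ f xo + h xo + 4 * mu * D ^ 2 := by
  set M := Lf + rho * ‖A‖ ^ 2 with hM
  have M0 : 0 < M := by positivity
  have D0 : 0 ≤ D := (norm_nonneg _).trans (hdiam _ hxo _ hxo)
  have h1 := hP xo hxo
  have h2 := convex_fo hfc hf.1 xt xo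
  have h3 := descent hf xt P
  set r := A P - b with hr
  have cG : (2 * M + mu) * ⟪P - xt, xo - P⟫ ≤ 2 * mu * D * D := by
    have := real_inner_le_norm ((2 * M + mu) • (xt - P)) (P - xo)
    have e : (2 * M + mu) * ⟪P - xt, xo - P⟫ = ⟪(2 * M + mu) • (xt - P), P - xo⟫ := by
      rw [real_inner_smul_left, ← neg_sub xt P, ← neg_sub P xo, inner_neg_neg]
    rw [e]
    refine this.trans (mul_le_mul hG (hdiam _ hPm _ hxo) (norm_nonneg _) (by positivity))
  have hsm : M * ‖xt - P‖ ^ 2 ≤ mu * D ^ 2 := by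
    rw [norm_smul, Real.norm_eq_abs, abs_of_pos (by positivity)] at hG
    have s := pow_le_pow_left₀ (by positivity) hG 2
    have k : 8 * M * mu * ‖xt - P‖ ^ 2 ≤ ((2 * M + mu) * ‖xt - P‖) ^ 2 := by
      rw [mul_pow]
      apply mul_le_mul_of_nonneg_right _ (sq_nonneg _)
      nlinarith [sq_nonneg (2 * M - mu)]
    have : mu * (M * ‖xt - P‖ ^ 2) ≤ mu * (mu * D ^ 2) := by nlinarith [sq_nonneg (mu * D)]
    exact le_of_mul_le_mul_left this hmu
  have eA : A (xo - P) = -r := by rw [map_sub, hAo, hr]; abel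
  have eX : A xt - b = r + A (xt - P) := by rw [map_sub, hr]; abel
  rw [augGrad, inner_add_left, inner_add_left, real_inner_smul_left,
    ContinuousLinearMap.adjoint_inner_left, ContinuousLinearMap.adjoint_inner_left, eA, eX,
    inner_neg_right, inner_neg_right, inner_add_left, real_inner_self_eq_norm_sq] at h1
  have hcr : -⟪A (xt - P), r⟫ ≤ 1 / 4 * ‖r‖ ^ 2 + ‖A‖ ^ 2 * ‖xt - P‖ ^ 2 := by
    have c := real_inner_le_norm (-A (xt - P)) r
    rw [inner_neg_left, norm_neg] at c
    have o := A.le_opNorm (xt - P)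
    have o2 := pow_le_pow_left₀ (norm_nonneg _) o 2
    rw [mul_pow] at o2
    nlinarith [sq_nonneg (1 / 2 * ‖r‖ - ‖A (xt - P)‖)]
  have hcr2 := mul_le_mul_of_nonneg_left hcr hrho.le
  have eM : M * ‖xt - P‖ ^ 2 = Lf * ‖xt - P‖ ^ 2 + rho * (‖A‖ ^ 2 * ‖xt - P‖ ^ 2) := by
    rw [hM]; ring
  have q0 : 0 ≤ Lf * ‖xt - P‖ ^ 2 := by positivity
  rw [norm_sub_rev P xt] at h3
  have e5 : ⟪f' xt, xo - P⟫ = ⟪f' xt, xo - xt⟫ - ⟪f' xt, P - xt⟫ := by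
    rw [← inner_sub_right]; congr 1; abel
  have q1 : 0 ≤ mu * D ^ 2 := by positivity
  linarith

lemma outer {m : ℕ} {lam : ℕ → Euc m} {r : ℕ → Euc m} {ls : Euc m} {rho : ℝ}
    (hl : ∀ k, lam (k + 1) = lam k + rho • r k)
    (h0 : lam 0 = 0)
    (hs : ∀ k, rho * (⟪lam k - ls, r k⟫ + 3 / 4 * rho * ‖r k‖ ^ 2) ≤ 3 / 4) (N : ℕ) :
    (∃ k < N, rho * ‖r k‖ ≤ 3 ∧ ‖lam k - ls‖ ≤ ‖ls‖) ∨ ‖lam N - ls‖ ^ 2 ≤ ‖ls‖ ^ 2 - 3 * N := by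
  induction N with
  | zero => right; simp [h0]
  | succ N ih =>
    rcases ih with ⟨k, hk, h⟩ | ih
    · exact Or.inl ⟨k, by omega, h⟩
    · by_cases hc : rho * ‖r N‖ ≤ 3
      · left
        refine ⟨N, by omega, hc, ?_⟩
        refine (le_abs_self _).trans (abs_le_of_sq_le_sq ?_ (norm_nonneg _))
        have : (0 : ℝ) ≤ N := by positivity
        linarith
      · right
        push Not at hc
        have e : lam (N + 1) - ls = (lam N - ls) + rho • r N := by rw [hl]; abel
        rw [e, norm_add_sq_real, real_inner_smul_right, norm_smul, mul_pow, Real.norm_eq_abs, sq_abs]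
        have := hs N
        have : 9 < rho ^ 2 * ‖r N‖ ^ 2 := by nlinarith
        push_cast
        nlinarith

lemma le_exp_of_log {x W : ℝ} (hx : 0 ≤ x) (h : |Real.log x| ≤ W) : x ≤ Real.exp W := by
  rcases eq_or_lt_of_le hx with h0 | h0
  · rw [← h0]; positivity
  · rw [← Real.log_le_iff_le_exp h0]; exact (le_abs_self _).trans h

lemma final_num {Lf D eps R nA kap W J : ℝ} (hLf : 0 < Lf) (hD : 1 ≤ D) (heps : 0 < eps)
    (hR : 0 ≤ R) (hnA : 0 ≤ nA) (hk0 : 0 ≤ kap)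
    (hk : kap ≤ 16 * D ^ 2 * (6 * ((R + D) * Lf / eps) + 36 * ((R + D) * nA / eps) ^ 2))
    (hW1 : 1 ≤ W) (w1 : |Real.log D| ≤ W) (w2 : |Real.log Lf| ≤ W) (w3 : |Real.log nA| ≤ W)
    (w4 : |Real.log eps| ≤ W) (w5 : |Real.log R| ≤ W)
    (hJ : J ≤ (1 + Real.sqrt (2 * kap)) * Real.log (8 * (1 + kap) ^ 2) + 1) :
    J + 1 ≤ 1500 * W * (1 + D * (Real.sqrt ((R + D) * Lf / eps) + (R + D) * nA / eps)) := by
  have hT : 0 < R + D := by linarith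
  set s := Real.sqrt ((R + D) * Lf / eps) with hs
  set t := (R + D) * nA / eps with ht
  have s0 : 0 ≤ s := Real.sqrt_nonneg _
  have t0 : 0 ≤ t := by positivity
  have s2 : s ^ 2 = (R + D) * Lf / eps := Real.sq_sqrt (by positivity)
  have b1 : Real.sqrt (2 * kap) ≤ 34 * (D * (s + t)) := by
    apply Real.sqrt_le_iff.2 ⟨by positivity, ?_⟩
    rw [← s2] at hk
    have : 0 ≤ D ^ 2 * (s * t) := by positivity
    have : 0 ≤ D ^ 2 * s ^ 2 := by positivity
    have : 0 ≤ D ^ 2 * t ^ 2 := by positivity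
    nlinarith
  have b2 : Real.log (8 * (1 + kap) ^ 2) ≤ 43 * W := by
    rw [Real.log_le_iff_le_exp (by positivity)]
    set Q := Real.exp W with hQ
    have hQ2 : 2 ≤ Q := by
      have := Real.add_one_le_exp W
      linarith
    have q1 : D ≤ Q := le_exp_of_log (by linarith) w1
    have q2 : Lf ≤ Q := le_exp_of_log hLf.le w2
    have q3 : nA ≤ Q := le_exp_of_log hnA w3
    have q4 : eps⁻¹ ≤ Q := le_exp_of_log (by positivity) (by rwa [Real.log_inv, abs_neg])
    have q5 : R ≤ Q := le_exp_of_log hR w5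
    have qT : R + D ≤ 2 * Q := by linarith
    have e43 : Real.exp (43 * W) = Q ^ 43 := by rw [hQ, ← Real.exp_nat_mul]; norm_num
    rw [e43]
    have z1 : (R + D) * Lf / eps ≤ 2 * Q * Q * Q := by
      rw [div_eq_mul_inv]; gcongr
    have z2 : t ≤ 2 * Q * Q * Q := by
      rw [ht, div_eq_mul_inv]; gcongr
    have z3 : kap ≤ 16 * Q ^ 2 * (6 * (2 * Q * Q * Q) + 36 * (2 * Q * Q * Q) ^ 2) := by
      refine hk.trans ?_
      gcongr
    have p1 : Q ^ 5 ≤ Q ^ 8 := pow_le_pow_right₀ (by linarith) (by norm_num)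
    have p2 : (1:ℝ) ≤ Q ^ 8 := one_le_pow₀ (by linarith)
    have p3 : (2:ℝ) ^ 12 ≤ Q ^ 12 := pow_le_pow_left₀ (by norm_num) hQ2 12
    have p4 : (2:ℝ) ^ 3 ≤ Q ^ 3 := pow_le_pow_left₀ (by norm_num) hQ2 3
    have z4 : 1 + kap ≤ Q ^ 20 := by
      calc 1 + kap ≤ 2 ^ 12 * Q ^ 8 := by nlinarith
        _ ≤ Q ^ 12 * Q ^ 8 := by gcongr
        _ = Q ^ 20 := by ring
    calc 8 * (1 + kap) ^ 2 ≤ Q ^ 3 * (Q ^ 20) ^ 2 := by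
          gcongr
          linarith
      _ = Q ^ 43 := by ring
  have b3 : (1 + Real.sqrt (2 * kap)) * Real.log (8 * (1 + kap) ^ 2) ≤
      (1 + 34 * (D * (s + t))) * (43 * W) := by
    have : 0 ≤ Real.log (8 * (1 + kap) ^ 2) := Real.log_nonneg (by nlinarith)
    apply mul_le_mul _ b2 this (by positivity)
    linarith
  have : 0 ≤ D * (s + t) := by positivity
  have : 0 ≤ W * (D * (s + t)) := by positivity
  nlinarith

lemma sum_end {J : ℕ → ℕ} {K : ℕ} {W X Z R : ℝ} (hW : 0 ≤ W) (hX : 0 ≤ X)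
    (hJk : ∀ k, (J k : ℝ) + 1 ≤ 1500 * W * X) (hK1 : ((K : ℝ) + 1) ≤ 1 + R ^ 2) (hZ : W ≤ Z) :
    ∑ k ∈ Finset.range (K + 1), ((J k : ℝ) + 1) ≤ 1500 * Z * ((1 + R ^ 2) * X) := by
  calc ∑ k ∈ Finset.range (K + 1), ((J k : ℝ) + 1)
        ≤ ∑ k ∈ Finset.range (K + 1), 1500 * W * X := Finset.sum_le_sum fun k _ => hJk k
      _ = (K + 1) * (1500 * W * X) := by simp
      _ ≤ (1 + R ^ 2) * (1500 * Z * X) := by gcongr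
      _ = _ := by ring

set_option maxHeartbeats 1000000 in
theorem ialm_primal_complexity :
    ∃ c : ℝ, 0 < c ∧
      ∀ (n m : ℕ) (domh : Set (Euc n)) (f h : Euc n → ℝ) (f' : Euc n → Euc n)
        (A : Euc n →L[ℝ] Euc m) (bvec : Euc m)
        (Lf D eps alpha : ℝ)
        -- standing assumptions
        (_ : 0 < Lf) (_ : ConvexOn ℝ Set.univ f) (_ : HasLipGrad f f' Lf)
        (_ : LowerSemicontinuous f)
        (_ : ConvexOn ℝ domh h) (_ : IsClosed domh)
        (_ : LowerSemicontinuousOn h domh) (_ : domh.Nonempty)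
        (_ : ∃ xs ∈ intrinsicInterior ℝ domh, A xs = bvec)
        (_ : 1 ≤ D) (_ : ∀ u ∈ domh, ∀ w ∈ domh, ‖u - w‖ ≤ D)
        (_ : 0 < eps) (_ : 0 < alpha) (_ : alpha < 1)
        -- the optimal value `φ̂_*` of the constrained problem
        (xopt : Euc n) (phistar : ℝ)
        (_ : xopt ∈ domh) (_ : A xopt = bvec) (_ : phistar = f xopt + h xopt)
        (_ : ∀ u ∈ domh, A u = bvec → phistar ≤ f u + h u)
        -- the Lagrangian dual, a maximizer `lamstar`, and `R_Λ = dist(λ₀, Λ_*)` (here `λ₀ = 0`)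
        (d : Euc m → ℝ)
        (_ : ∀ lam : Euc m,
            IsLeast ((fun x => f x + h x + ⟪lam, A x - bvec⟫) '' domh) (d lam))
        (lamstar : Euc m) (RLam : ℝ)
        (_ : ∀ nu : Euc m, d nu ≤ d lamstar)
        (_ : RLam = ‖lamstar‖)
        (_ : ∀ lam' : Euc m, (∀ nu, d nu ≤ d lam') → RLam ≤ ‖lam'‖),
        -- there is an internal target accuracy `eps' ≤ eps` such that every run of
        -- Algorithm 3 with the parameter choices of the complexity theorem at accuracy
        -- `eps'` finds an `ε`-primal solution within the stated iteration bound
        ∃ eps' : ℝ, 0 < eps' ∧ eps' ≤ eps ∧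
          ∀ (xseq : ℕ → Euc n) (lamseq : ℕ → Euc m)
            (xin yin xtin ytin : ℕ → ℕ → Euc n) (ain Ain tauin : ℕ → ℕ → ℝ)
            (P Gm : ℕ → ℕ → Euc n) (J : ℕ → ℕ)
            (_ : ALMSpec domh f h f' A bvec Lf D eps'⁻¹ eps' eps' alpha (1 / 2)
                xseq lamseq xin yin xtin ytin ain Ain tauin P Gm J),
            ∃ K : ℕ,
              -- `x_{K+1}` is an `ε`-primal solution
              |f (xseq (K + 1)) + h (xseq (K + 1)) - phistar| ≤ eps ∧
              ‖A (xseq (K + 1)) - bvec‖ ≤ eps ∧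
              -- total number of ACG iterations
              (∑ k ∈ Finset.range (K + 1), ((J k : ℝ) + 1)) ≤
                c * (1 + |Real.log D| + |Real.log Lf| + |Real.log ‖A‖| +
                    |Real.log eps| + |Real.log (1 - alpha)| + |Real.log RLam|) ^ c *
                  ((1 + RLam ^ 2) *
                    (1 + D * (Real.sqrt ((RLam + D) * Lf / eps) +
                      (RLam + D) * ‖A‖ / eps))) := by
  refine ⟨1500, by norm_num, ?_⟩
  intro n m domh f h f' A bvec Lf D eps alpha hLf hfc hf _ hh hcl hls hne _ hD hdiam heps hal hal1
    xopt phistar hxo hAo hphi hopt d hd lamstar RLam hmax hRL _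
  have hR : 0 ≤ RLam := by rw [hRL]; positivity
  have hT : 0 < RLam + D := by linarith
  have hdual := strong_dual hfc (grad_cont hf) hh hcl hls hne hdiam hopt hd hmax
  refine ⟨eps / (6 * (RLam + D)), by positivity, div_le_self heps.le (by linarith), ?_⟩
  set e' := eps / (6 * (RLam + D)) with he'
  have e0 : 0 < e' := by positivity
  have eT : e' * (6 * (RLam + D)) = eps := by rw [he']; field_simp
  intro xseq lamseq xin yin xtin ytin ain Ain tauin P Gm J S
  obtain ⟨hl0, hacg, hprox, hGm, hAtJ, hBefore, hx, hlam⟩ := S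
  have hek : ∀ k, e' / 4 ≤ epsALM e' alpha (1 / 2) e'⁻¹ e' k ∧
      epsALM e' alpha (1 / 2) e'⁻¹ e' k ≤ 3 / 4 * e' := by
    intro k
    have h1 : 0 ≤ alpha ^ k := by positivity
    have h2 : alpha ^ k ≤ 1 := pow_le_one₀ hal.le hal1.le
    have h3 : (1 / 2 : ℝ) * e'⁻¹ * e' ^ 2 = e' / 2 := by field_simp
    rw [epsALM, h3]
    constructor <;> nlinarith
  generalize epsALM e' alpha (1 / 2) e'⁻¹ e' = E at *
  set M := Lf + e'⁻¹ * ‖A‖ ^ 2 with hM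
  have M0 : 0 < M := by positivity
  obtain ⟨mu, hmu⟩ : ∃ mu : ℕ → ℝ, ∀ k, E k / (4 * D ^ 2) = mu k := ⟨_, fun _ => rfl⟩
  have hmu8 : ∀ k, E k / (8 * D ^ 2) = mu k / 2 := by intro k; rw [← hmu]; field_simp; ring
  have hmu2 : ∀ k, E k / (2 * D) = 2 * mu k * D := by intro k; rw [← hmu]; field_simp; ring
  have hE : ∀ k, E k = 4 * mu k * D ^ 2 := by intro k; rw [← hmu]; field_simp
  simp only [hmu, hmu8, hmu2] at hacg hprox hGm hAtJ hBefore hx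
  have mu0 : ∀ k, 0 < mu k := by
    intro k; rw [← hmu]; have := (hek k).1
    have : 0 < E k := by linarith
    positivity
  have c0 : ∀ k, 0 < 2 * M + mu k := fun k => by have := mu0 k; positivity
  have hxP : ∀ k, xseq (k + 1) = P k (J k) := by
    intro k
    rw [hx, hGm, smul_smul, inv_mul_cancel₀ (c0 k).ne', one_smul]; abel
  have hPfo := fun k j => prox_fo2 hh (c0 k) (hprox k j)
  have hPm : ∀ k j, P k j ∈ domh := fun k j => (hprox k j).1
  -- outer iterations
  have hstep : ∀ k, f (xseq (k + 1)) + h (xseq (k + 1)) + ⟪lamseq k, A (xseq (k + 1)) - bvec⟫ +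
      3 / 4 * e'⁻¹ * ‖A (xseq (k + 1)) - bvec‖ ^ 2 ≤ phistar + E k := by
    intro k
    rw [hxP, hE, hphi]
    refine alm_step hLf (by positivity) (mu0 k) hfc hf hdiam hxo hAo (hPm k (J k)) (hPfo k (J k)) ?_
    rw [← hM, ← hGm]; exact hAtJ k
  have hout := outer (lam := lamseq) (r := fun k => A (xseq (k + 1)) - bvec) (ls := lamstar)
    (rho := e'⁻¹) hlam hl0 (by
      intro k
      have h1 := hstep k
      have h2 := hdual (xseq (k + 1)) (by rw [hxP]; exact hPm _ _)
      have h3 := (hek k).2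
      have h4 : ⟪lamseq k - lamstar, A (xseq (k + 1)) - bvec⟫ +
          3 / 4 * e'⁻¹ * ‖A (xseq (k + 1)) - bvec‖ ^ 2 ≤ 3 / 4 * e' := by
        rw [inner_sub_left]; linarith
      calc _ ≤ e'⁻¹ * (3 / 4 * e') := mul_le_mul_of_nonneg_left h4 (by positivity)
        _ = 3 / 4 := by field_simp) (⌊RLam ^ 2⌋₊ + 1)
  have hN1 : RLam ^ 2 < (⌊RLam ^ 2⌋₊ : ℝ) + 1 := Nat.lt_floor_add_one _
  have hN2 : (⌊RLam ^ 2⌋₊ : ℝ) ≤ RLam ^ 2 := Nat.floor_le (by positivity)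
  rw [← hRL] at hout
  obtain ⟨K, hK, hrK, hlK⟩ := hout.resolve_right (by
    push_cast
    intro hc
    have : 0 ≤ ‖lamseq (⌊RLam ^ 2⌋₊ + 1) - lamstar‖ ^ 2 := by positivity
    nlinarith [sq_nonneg RLam])
  have hr3 : ‖A (xseq (K + 1)) - bvec‖ ≤ 3 * e' := by
    rw [inv_mul_le_iff₀ e0] at hrK; linarith
  have hlK2 : ‖lamseq K‖ ≤ 2 * RLam := by
    have := norm_add_le (lamseq K - lamstar) lamstar
    rw [sub_add_cancel, ← hRL] at this
    linarith
  have hRe : 0 ≤ RLam * e' := by positivity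
  have hDe : e' ≤ D * e' := by nlinarith
  refine ⟨K, ?_, ?_, ?_⟩
  · rw [abs_le]
    constructor
    · have h2 := hdual (xseq (K + 1)) (by rw [hxP]; exact hPm _ _)
      have h3 := real_inner_le_norm lamstar (A (xseq (K + 1)) - bvec)
      rw [← hRL] at h3
      have h4 := mul_le_mul_of_nonneg_left hr3 hR
      nlinarith
    · have h1 := hstep K
      have h3 := real_inner_le_norm (-lamseq K) (A (xseq (K + 1)) - bvec)
      rw [inner_neg_left, norm_neg] at h3
      have h4 : ‖lamseq K‖ * ‖A (xseq (K + 1)) - bvec‖ ≤ 2 * RLam * (3 * e') :=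
        mul_le_mul hlK2 hr3 (norm_nonneg _) (by positivity)
      have h5 : 0 ≤ 3 / 4 * e'⁻¹ * ‖A (xseq (K + 1)) - bvec‖ ^ 2 := by positivity
      have h6 := (hek K).2
      nlinarith
  · nlinarith
  · set W := 1 + |Real.log D| + |Real.log Lf| + |Real.log ‖A‖| +
                    |Real.log eps| + |Real.log (1 - alpha)| + |Real.log RLam| with hW
    have a1 := abs_nonneg (Real.log D)
    have a2 := abs_nonneg (Real.log Lf)
    have a3 := abs_nonneg (Real.log ‖A‖)
    have a4 := abs_nonneg (Real.log eps)
    have a5 := abs_nonneg (Real.log (1 - alpha))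
    have a6 := abs_nonneg (Real.log RLam)
    have hW1 : 1 ≤ W := by linarith
    set X := 1 + D * (Real.sqrt ((RLam + D) * Lf / eps) + (RLam + D) * ‖A‖ / eps) with hX
    have X0 : 0 ≤ X := by positivity
    have hJk : ∀ k, (J k : ℝ) + 1 ≤ 1500 * W * X := by
      intro k
      have hup0 := fun x u => descent hf x u
      have hlo0 := fun x u => convex_fo hfc hf.1 x u
      have ei0 : 0 < e'⁻¹ := by positivity
      obtain ⟨xs, hxs, hmin⟩ := exists_min hcl hls hne hdiam
        (fun u => f u + ⟪lamseq k, A u - bvec⟫ + e'⁻¹ / 2 * ‖A u - bvec‖ ^ 2 +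
          mu k / 2 * ‖u - xseq k‖ ^ 2) (by have := grad_cont hf; fun_prop)
      have hJb := J_bound (hacg k) M0 (mu0 k) hD hh hdiam
        (by
          intro x u
          have e1 := aug_eq f f' A bvec (lamseq k) e'⁻¹ (mu k) (xseq k) x u
          have e2 := hlo0 x u
          have e3 : 0 ≤ e'⁻¹ / 2 * ‖A (u - x)‖ ^ 2 := by positivity
          linarith)
        (by
          intro x u
          have e1 := aug_eq f f' A bvec (lamseq k) e'⁻¹ (mu k) (xseq k) x u
          have e2 := hup0 x u
          have o := pow_le_pow_left₀ (norm_nonneg _) (A.le_opNorm (u - x)) 2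
          have e3 := mul_le_mul_of_nonneg_left o ei0.le
          rw [mul_pow] at e3
          have e4 : M * ‖u - x‖ ^ 2 = Lf * ‖u - x‖ ^ 2 + e'⁻¹ * (‖A‖ ^ 2 * ‖u - x‖ ^ 2) := by
            rw [hM]; ring
          linarith)
        hxs hmin (fun u => rfl) (hPm k) (hPfo k) (hGm k) (hBefore k)
      refine final_num hLf hD heps hR (norm_nonneg A) (by have := mu0 k; positivity) ?_ hW1
        (by linarith) (by linarith) (by linarith) (by linarith) (by linarith) hJb
      have hm : e' / (16 * D ^ 2) ≤ mu k := by
        have := (hek k).1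
        rw [hE] at this
        rw [div_le_iff₀ (by positivity)]; linarith
      calc M / mu k ≤ M / (e' / (16 * D ^ 2)) :=
            div_le_div_of_nonneg_left M0.le (by positivity) hm
        _ = _ := by rw [hM, he']; field_simp; try ring
    have hK1 : ((K : ℝ) + 1) ≤ 1 + RLam ^ 2 := by
      have : (K : ℝ) + 1 ≤ (⌊RLam ^ 2⌋₊ : ℝ) + 1 := by exact_mod_cast hK
      linarith
    have hWc : W ≤ W ^ (1500 : ℝ) := Real.self_le_rpow_of_one_le hW1 (by norm_num)
    exact sum_end (zero_le_one.trans hW1) X0 hJk hK1 hWc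
end
end

section
/- In the LOrA framework with 𝒜_k = ∞ at all iterations, let X_* be the (nonempty) set of minimizers of Φ, R_0 = min{‖x_0 − x‖ : x ∈ X_*}, and δ̄_k = (1/k)Σ_{i=0}^{k−1} δ_i. Then for every k ≥ 1: (i) min_{1≤i≤k} ‖y_i − x_{i−1}‖ ≤ R_0/(√(1−σ)√k) + √(2λδ̄_k/(1−σ)); and (ii) min_{1≤i≤k} Φ(y_i) − Φ(x_*) ≤ R_0²/(2λk) + δ̄_k. -/
noncomputable section

open Set
open scoped RealInnerProductSpace BigOperators

variable {n m : ℕ}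

/-!
STATEMENT 9 (Theorem: sub-optimality guarantees of the LOrA framework with `𝒜_k = ∞`).
-/

theorem lora_complexity
    (domPhi : Set (Euc n)) (Phi : Euc n → ℝ) (Gam : ℕ → Euc n → ℝ)
    (sigma lam : ℝ) (delta : ℕ → ℝ)
    (hsigma0 : 0 < sigma) (hsigma1 : sigma < 1) (hlam : 0 < lam)
    (hdelta : ∀ k, 0 < delta k)
    (hPhiconv : ConvexOn ℝ domPhi Phi)
    (hPhilsc : LowerSemicontinuousOn Phi domPhi)
    (x y : ℕ → Euc n)
    (hy0 : y 0 = x 0) (hx0 : x 0 ∈ domPhi)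
    (hymem : ∀ k, y (k + 1) ∈ domPhi) (hxmem : ∀ k, x (k + 1) ∈ domPhi)
    (hGamsc : ∀ k, SCOn domPhi (1 / lam) (Gam k))
    (hGamle : ∀ k, ∀ z ∈ domPhi, Gam k z ≤ Phi z + ‖z - x k‖ ^ 2 / (2 * lam))
    -- `𝒜_k = ∞` at all iterations: `x_{k+1}` minimizes `Γ_k` and `û_{k+1} = 0`
    (hxmin : ∀ k, ∀ z ∈ domPhi, Gam k (x (k + 1)) ≤ Gam k z)
    -- inexactness condition (with `û_{k+1} = 0`)
    (hineq : ∀ k,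
        2 * lam * (Phi (y (k + 1)) + ‖y (k + 1) - x k‖ ^ 2 / (2 * lam) -
          Gam k (x (k + 1))) ≤
        sigma * ‖y (k + 1) - x k‖ ^ 2 + 2 * lam * delta k)
    -- `xstar` attains the minimum distance `R0` from `x 0` to the solution set
    (xstar : Euc n) (R0 : ℝ)
    (hxstar : xstar ∈ domPhi) (hxstarmin : ∀ z ∈ domPhi, Phi xstar ≤ Phi z)
    (hR0 : R0 = ‖x 0 - xstar‖)
    (hR0min : ∀ z ∈ domPhi, (∀ u ∈ domPhi, Phi z ≤ Phi u) → R0 ≤ ‖x 0 - z‖) :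
    ∀ k : ℕ, 1 ≤ k →
      (∃ i, 1 ≤ i ∧ i ≤ k ∧
        ‖y i - x (i - 1)‖ ≤ R0 / (Real.sqrt (1 - sigma) * Real.sqrt k) +
          Real.sqrt (2 * lam * ((∑ j ∈ Finset.range k, delta j) / k) / (1 - sigma))) ∧
      (∃ i, 1 ≤ i ∧ i ≤ k ∧
        Phi (y i) - Phi xstar ≤ R0 ^ 2 / (2 * lam * k) +
          (∑ j ∈ Finset.range k, delta j) / k) := by
  have key : ∀ k, Gam k (x (k + 1)) + ‖x (k + 1) - xstar‖ ^ 2 / (2 * lam) ≤ Gam k xstar := by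
    intro k
    have h1 : ∀ a : ℝ, 0 ≤ a → a < 1 →
        a * (‖x (k + 1) - xstar‖ ^ 2 / (2 * lam)) ≤ Gam k xstar - Gam k (x (k + 1)) := by
      intro a ha0 ha1
      have hc : 0 < 1 - a := by linarith
      have e1 := hGamsc k (hxmem k) hxstar ha0 hc.le (by ring)
      have e2 := hxmin k _ (hPhiconv.1 (hxmem k) hxstar ha0 hc.le (by ring))
      have e3 : 1 / lam / 2 * (a * (1 - a)) * ‖x (k + 1) - xstar‖ ^ 2
          = (1 - a) * (a * (‖x (k + 1) - xstar‖ ^ 2 / (2 * lam))) := by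
        field_simp
      rw [e3] at e1
      refine le_of_mul_le_mul_left ?_ hc
      linarith
    have h2 : (1 : ℝ) * (‖x (k + 1) - xstar‖ ^ 2 / (2 * lam))
        ≤ Gam k xstar - Gam k (x (k + 1)) := by
      set D := ‖x (k + 1) - xstar‖ ^ 2 / (2 * lam) with hD
      have hD0 : 0 ≤ D := by positivity
      by_contra hcon
      push Not at hcon
      set g := Gam k xstar - Gam k (x (k + 1)) with hg
      have hg0 : 0 ≤ g := by
        have := hxmin k xstar hxstar
        linarith
      have hDp : 0 < D := by linarith
      have h3 := h1 ((g + D) / (2 * D)) (by positivity) (by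
        rw [div_lt_one (by positivity)]; linarith)
      have h4 : (g + D) / (2 * D) * D = (g + D) / 2 := by field_simp
      linarith
    linarith
  have step : ∀ k, 2 * lam * (Phi (y (k + 1)) - Phi xstar)
      + (1 - sigma) * ‖y (k + 1) - x k‖ ^ 2
      ≤ ‖x k - xstar‖ ^ 2 - ‖x (k + 1) - xstar‖ ^ 2 + 2 * lam * delta k := by
    intro k
    have a1 := key k
    have a2 := hGamle k xstar hxstar
    rw [norm_sub_rev xstar (x k)] at a2
    have a3 := mul_le_mul_of_nonneg_left (a1.trans a2) (by positivity : 0 ≤ 2 * lam)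
    have a4 := hineq k
    have c : ∀ t : ℝ, 2 * lam * (t / (2 * lam)) = t := fun t => by field_simp
    rw [mul_add, mul_add, c, c] at a3
    rw [mul_sub, mul_add, c] at a4
    linarith
  have tot : ∀ k : ℕ, ∑ j ∈ Finset.range k, (2 * lam * (Phi (y (j + 1)) - Phi xstar)
      + (1 - sigma) * ‖y (j + 1) - x j‖ ^ 2)
      ≤ R0 ^ 2 + 2 * lam * ∑ j ∈ Finset.range k, delta j := by
    intro k
    have : ∑ j ∈ Finset.range k, (2 * lam * (Phi (y (j + 1)) - Phi xstar)
      + (1 - sigma) * ‖y (j + 1) - x j‖ ^ 2)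
      ≤ R0 ^ 2 - ‖x k - xstar‖ ^ 2 + 2 * lam * ∑ j ∈ Finset.range k, delta j := by
      induction k with
      | zero => simp [hR0]
      | succ k ih =>
        rw [Finset.sum_range_succ, Finset.sum_range_succ]
        have := step k
        linarith
    have h := sq_nonneg ‖x k - xstar‖
    linarith
  intro k hk
  have hkp : (0 : ℝ) < k := by exact_mod_cast hk
  have hs : 0 < 1 - sigma := by linarith
  have hR : 0 ≤ R0 := by rw [hR0]; positivity
  set S := ∑ j ∈ Finset.range k, delta j with hS
  have hS0 : 0 ≤ S := Finset.sum_nonneg fun j _ => (hdelta j).le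
  obtain ⟨i, hi, hle⟩ : ∃ i ∈ Finset.range k, 2 * lam * (Phi (y (i + 1)) - Phi xstar)
      + (1 - sigma) * ‖y (i + 1) - x i‖ ^ 2 ≤ (R0 ^ 2 + 2 * lam * S) / k := by
    apply Finset.exists_le_of_sum_le (by simpa using (by omega : k ≠ 0))
    have := tot k
    simp only [Finset.sum_const, Finset.card_range, nsmul_eq_mul]
    rw [mul_div_cancel₀ _ hkp.ne']
    exact this
  have hik := Finset.mem_range.mp hi
  have hP : 0 ≤ Phi (y (i + 1)) - Phi xstar := by
    have := hxstarmin _ (hymem i)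
    linarith
  refine ⟨⟨i + 1, by omega, by omega, ?_⟩, ⟨i + 1, by omega, by omega, ?_⟩⟩
  · simp only [Nat.add_sub_cancel]
    set N := ‖y (i + 1) - x i‖ with hN
    have hb : 0 ≤ 2 * lam * (S / k) / (1 - sigma) := by positivity
    have ha : 0 ≤ R0 / (Real.sqrt (1 - sigma) * Real.sqrt k) := by positivity
    have hP2 : 0 ≤ 2 * lam * (Phi (y (i + 1)) - Phi xstar) := by positivity
    have hN2 : N ^ 2 ≤ ((R0 ^ 2 + 2 * lam * S) / k) / (1 - sigma) := by
      rw [le_div_iff₀ hs]; linarith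
    have ha2 : (R0 / (Real.sqrt (1 - sigma) * Real.sqrt k)) ^ 2
        = R0 ^ 2 / ((1 - sigma) * k) := by
      rw [div_pow, mul_pow, Real.sq_sqrt hs.le, Real.sq_sqrt hkp.le]
    have hb2 := Real.sq_sqrt hb
    have hb0 := Real.sqrt_nonneg (2 * lam * (S / k) / (1 - sigma))
    have he : ((R0 ^ 2 + 2 * lam * S) / k) / (1 - sigma)
        = R0 ^ 2 / ((1 - sigma) * k) + 2 * lam * (S / k) / (1 - sigma) := by
      field_simp
    refine (sq_le_sq₀ (norm_nonneg _) (by positivity)).mp ?_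
    rw [add_sq, ha2, hb2]
    have := mul_nonneg ha hb0
    linarith
  · have hN2 : 0 ≤ (1 - sigma) * ‖y (i + 1) - x i‖ ^ 2 := by positivity
    have he : R0 ^ 2 / (2 * lam * k) + S / k = ((R0 ^ 2 + 2 * lam * S) / k) / (2 * lam) := by
      field_simp
    rw [he, le_div_iff₀ (by positivity)]
    linarith
end
end
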